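/- Fix m ≥ 2, a bounded open connected set Ω ⊂ ℝ^m, d ≥ 5, and l ∈ ℕ. Let V_i^j : ℝ^m × ℝ^l → ℝ (i = 1,…,d, j = 1,…,m) be maps such that (x,z) ↦ V_i^j(x,z) is real analytic on a neighborhood of cl(Ω) × ℝ^l, and suppose that for some ẑ ∈ ℝ^l the Lie algebra Lie(V_1(·,ẑ),…,V_d(·,ẑ)) contains every polynomial vector field on ℝ^m. Then there exists a Lebesgue nullset ℳ ⊂ ℝ^l such that for every z ∈ ℝ^l ∖ ℳ and every N ∈ ℕ there exists a Lebesgue nullset 𝒩_N ⊂ Ω^N (depending on z and N) with the following property: for every tuple (x_1,…,x_N) ∈ Ω^N ∖ 𝒩_N and every tuple of pairwise distinct points y_1,…,y_N ∈ Ω, there exist a constant λ > 0 and smooth controls u^1,…,u^d : [0,1] → ℝ such that the solutions X^{x_i} of d/dt X_t = Σ_{j=1}^d u^j_t V_j(X_t, z), X_0 = x_i, satisfy y_i = λ(X^{x_i}_1 − x_i) for all i = 1,…,N. Consequently, if Z is a random vector in ℝ^l whose law has a density with respect to Lebesgue measure and the inputs (x_1,…,x_N) are drawn from a density on (ℝ^m)^N,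 this matching property holds with probability one. -/

import Mathlib

open Set MeasureTheory

noncomputable section

/-- The Lie bracket `[U,V](x) = DV(x)·U(x) − DU(x)·V(x)` of two vector fields. -/
def lieBracketVF {F : Type*} [NormedAddCommGroup F] [NormedSpace ℝ F]
    (U V : F → F) : F → F :=
  fun x => fderiv ℝ V x (U x) - fderiv ℝ U x (V x)

/-- `lieGen S` is the smallest ℝ-linear subspace of vector fields containing `S`
and closed under the Lie bracket. -/
def lieGen {F : Type*} [NormedAddCommGroup F] [NormedSpace ℝ F]
    (S : Set (F → F)) : Set (F → F) :=
  ⋂₀ {T : Set (F → F) | S ⊆ T ∧ (0 : F → F) ∈ T ∧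
      (∀ f g, f ∈ T → g ∈ T → f + g ∈ T) ∧
      (∀ (c : ℝ) f, f ∈ T → c • f ∈ T) ∧
      (∀ f g, f ∈ T → g ∈ T → lieBracketVF f g ∈ T)}

/-- A polynomial vector field on `ℝ^m`. -/
def IsPolyVF {m : ℕ} (V : EuclideanSpace ℝ (Fin m) → EuclideanSpace ℝ (Fin m)) : Prop :=
  ∃ p : Fin m → MvPolynomial (Fin m) ℝ,
    ∀ x j, V x j = MvPolynomial.eval (fun k => x k) (p j)

/-- The matching property for the readout `y = λ(X^x_1 − x)`: there are a constant `λ > 0`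
and smooth controls `u^1,…,u^d` such that the solutions `X^{x_i}` of the controlled ODE
`d/dt X_t = ∑_j u^j_t V_j(X_t)`, `X_0 = x_i`, satisfy `y_i = λ(X^{x_i}_1 − x_i)` for all `i`. -/
def MatchesWithReadout {m d N : ℕ}
    (V : Fin d → EuclideanSpace ℝ (Fin m) → EuclideanSpace ℝ (Fin m))
    (xbar y : Fin N → EuclideanSpace ℝ (Fin m)) : Prop :=
  ∃ lam : ℝ, 0 < lam ∧
    ∃ u : Fin d → ℝ → ℝ,
      (∀ j, ContDiff ℝ (⊤ : ℕ∞) (u j)) ∧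
      ∀ i, ∃ X : ℝ → EuclideanSpace ℝ (Fin m),
        X 0 = xbar i ∧
        (∀ t ∈ Set.Icc (0:ℝ) 1, HasDerivAt X (∑ j, u j t • V j (X t)) t) ∧
        y i = lam • (X 1 - xbar i)

open scoped Topology ContDiff unitInterval

section Superposition

universe u

variable {K : Type*} [TopologicalSpace K] [CompactSpace K] {E F : Type u}
  [NormedAddCommGroup E] [NormedSpace ℝ E] [NormedAddCommGroup F] [NormedSpace ℝ F]

/-- Pointwise application of a continuous family of operators to a continuous family of vectors. -/
def pointwiseApply (K : Type*) [TopologicalSpace K] [CompactSpace K] (E F : Type*)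
    [NormedAddCommGroup E] [NormedSpace ℝ E] [NormedAddCommGroup F] [NormedSpace ℝ F] :
    C(K, E →L[ℝ] F) →L[ℝ] C(K, E) →L[ℝ] C(K, F) :=
  LinearMap.mkContinuous₂
    (LinearMap.mk₂ ℝ
      (fun (A : C(K, E →L[ℝ] F)) (X : C(K, E)) => (⟨fun s => A s (X s), by fun_prop⟩ : C(K, F)))
      (fun A B X => by ext; simp) (fun c A X => by ext; simp)
      (fun A X Y => by ext; simp) (fun c A X => by ext; simp)) 1
    (fun A X => by
      rw [one_mul, ContinuousMap.norm_le _ (by positivity)]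
      intro s
      simpa using ((A s).le_opNorm (X s)).trans
        (mul_le_mul (A.norm_coe_le_norm s) (X.norm_coe_le_norm s) (norm_nonneg _) (norm_nonneg _)))

@[simp] lemma pointwiseApply_apply (A : C(K, E →L[ℝ] F)) (X : C(K, E)) (s : K) :
    pointwiseApply K E F A X s = A s (X s) := rfl

/-- The superposition operator `X ↦ g ∘ X` is differentiable when `g` is `C¹`. -/
lemma hasFDerivAt_superposition {g : C(E, F)} (hg : ContDiff ℝ 1 g) (X : C(K, E)) :
    HasFDerivAt (fun Y : C(K, E) => g.comp Y)
      (pointwiseApply K E F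
        ((⟨fderiv ℝ g, hg.continuous_fderiv one_ne_zero⟩ : C(E, E →L[ℝ] F)).comp X)) X := by
  set Dg : C(E, E →L[ℝ] F) := ⟨fderiv ℝ g, hg.continuous_fderiv one_ne_zero⟩ with hDg
  refine HasFDerivAt.of_isLittleO ?_
  rw [Asymptotics.isLittleO_iff]
  intro ε hε
  have hcont : ContinuousAt (fun Y : C(K, E) => Dg.comp Y) X :=
    (ContinuousMap.continuous_postcomp Dg).continuousAt
  obtain ⟨δ, hδ, hball⟩ := (Metric.continuousAt_iff
    (f := fun Y : C(K, E) => Dg.comp Y)).1 hcont ε hε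
  filter_upwards [Metric.ball_mem_nhds X hδ] with Y hY
  rw [ContinuousMap.norm_le _ (by positivity)]
  intro s
  have key : ∀ y ∈ segment ℝ (X s) (Y s), ‖fderiv ℝ g y - fderiv ℝ g (X s)‖ ≤ ε := by
    intro y hy
    rw [segment_eq_image'] at hy
    obtain ⟨θ, ⟨h0, h1⟩, rfl⟩ := hy
    have hdist : dist (X + θ • (Y - X)) X < δ := by
      rw [dist_eq_norm, add_sub_cancel_left, norm_smul, Real.norm_of_nonneg h0]
      rw [Metric.mem_ball, dist_eq_norm] at hY
      exact (mul_le_of_le_one_left (norm_nonneg _) h1).trans_lt hY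
    have := hball hdist
    rw [← dist_eq_norm]
    exact (ContinuousMap.dist_apply_le_dist s).trans this.le
  have := (convex_segment (𝕜 := ℝ) (X s) (Y s)).norm_image_sub_le_of_norm_hasFDerivWithin_le'
    (f := g) (f' := fderiv ℝ g) (φ := fderiv ℝ g (X s)) (C := ε)
    (fun y _ => ((hg.differentiable one_ne_zero) y).hasFDerivAt.hasFDerivWithinAt) key
    (left_mem_segment ℝ _ _) (right_mem_segment ℝ _ _)
  refine (le_trans ?_ this).trans (mul_le_mul_of_nonneg_left ?_ hε.le)
  · simp [hDg]
  · simpa using (Y - X).norm_coe_le_norm s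

lemma contDiff_superposition (n : ℕ) {E F : Type u} [NormedAddCommGroup E] [NormedSpace ℝ E]
    [NormedAddCommGroup F] [NormedSpace ℝ F] {g : C(E, F)} (hg : ContDiff ℝ n g) :
    ContDiff ℝ n (fun Y : C(K, E) => g.comp Y) := by
  induction n generalizing F with
  | zero =>
    exact contDiff_zero.2 (ContinuousMap.continuous_postcomp _)
  | succ n ih =>
    have h1 : ContDiff ℝ 1 g := hg.of_le (by norm_cast; omega)
    have h2 : ContDiff ℝ n (fderiv ℝ g) := hg.fderiv_right (by norm_cast)
    rw [Nat.cast_add, Nat.cast_one, contDiff_succ_iff_hasFDerivAt]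
    refine ⟨_, ?_, hasFDerivAt_superposition h1⟩
    exact (pointwiseApply K E F).contDiff.comp
      (ih (g := ⟨fderiv ℝ g, h1.continuous_fderiv one_ne_zero⟩) h2)

end Superposition

section LocalFlow

variable {G : Type*} [NormedAddCommGroup G] [NormedSpace ℝ G]

/-- The operator sending `f` to the primitive of `b • f` vanishing at `0`. -/
def weightedPrimitive {b : ℝ → ℝ} (hb : Continuous b) (G : Type*) [NormedAddCommGroup G]
    [NormedSpace ℝ G] : C(I, G) →L[ℝ] C(I, G) :=
  have hint : ∀ (f : C(I, G)) (x y : ℝ), IntervalIntegrable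
      (fun r => b r • f (projIcc 0 1 zero_le_one r)) volume x y := fun f x y =>
    Continuous.intervalIntegrable (by fun_prop) x y
  LinearMap.mkContinuousOfExistsBound
    { toFun := fun f => ⟨fun s => ∫ r in (0 : ℝ)..s, b r • f (projIcc 0 1 zero_le_one r),
        (intervalIntegral.continuous_primitive (hint f) 0).comp continuous_subtype_val⟩
      map_add' := fun f g => by
        ext s
        simp only [ContinuousMap.add_apply, ContinuousMap.coe_mk, smul_add]
        exact intervalIntegral.integral_add (hint f 0 s) (hint g 0 s)
      map_smul' := fun c f => by
        ext s
        simp only [ContinuousMap.smul_apply, ContinuousMap.coe_mk, RingHom.id_apply,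
          smul_comm _ c]
        exact intervalIntegral.integral_smul c _ } <| by
    obtain ⟨C, hC⟩ := (isCompact_Icc (a := (0 : ℝ)) (b := 1)).exists_bound_of_continuousOn
      hb.continuousOn
    have hC0 : 0 ≤ C := (norm_nonneg _).trans (hC 0 (by simp))
    refine ⟨C, fun f => ?_⟩
    rw [ContinuousMap.norm_le _ (by positivity)]
    intro s
    refine (intervalIntegral.norm_integral_le_of_norm_le_const (C := C * ‖f‖) fun r hr => ?_).trans
      (mul_le_of_le_one_right (by positivity) ?_)
    · rw [norm_smul]
      rw [uIoc_of_le s.2.1] at hr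
      exact mul_le_mul (hC r ⟨hr.1.le, hr.2.trans s.2.2⟩) (f.norm_coe_le_norm _) (norm_nonneg _) hC0
    · rw [sub_zero, abs_of_nonneg s.2.1]
      exact s.2.2

lemma weightedPrimitive_apply {b : ℝ → ℝ} (hb : Continuous b) (f : C(I, G)) (s : I) :
    weightedPrimitive hb G f s = ∫ r in (0 : ℝ)..s, b r • f (projIcc 0 1 zero_le_one r) := rfl

/-- Solutions of the integral equation `X = x + τ • J (v ∘ X)` depend smoothly on `(τ, x)`. -/
lemma exists_contDiffAt_integral_solution {G : Type*} [NormedAddCommGroup G] [NormedSpace ℝ G]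
    [CompleteSpace G] {v : C(G, G)} (hv : ContDiff ℝ 2 v) (J : C(I, G) →L[ℝ] C(I, G)) (q : G) :
    ∃ Ψ : ℝ × G → C(I, G), ContDiffAt ℝ 2 Ψ (0, q) ∧ Ψ (0, q) = ContinuousMap.const I q ∧
      ∀ᶠ u in 𝓝 ((0 : ℝ), q), Ψ u = ContinuousMap.const I u.2 + u.1 • J (v.comp (Ψ u)) := by
  let c : G →L[ℝ] C(I, G) := ContinuousLinearMap.const ℝ I
  let f : (ℝ × G) × C(I, G) → C(I, G) := fun p => p.2 - c p.1.2 - p.1.1 • J (v.comp p.2)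
  have hf : ContDiff ℝ 2 f := by
    have := contDiff_superposition (K := I) 2 hv
    have h2 : ContDiff ℝ 2 fun p : (ℝ × G) × C(I, G) => v.comp p.2 := this.comp contDiff_snd
    fun_prop
  let u₀ : (ℝ × G) × C(I, G) := ((0, q), c q)
  have hinr : fderiv ℝ f u₀ ∘L .inr ℝ (ℝ × G) C(I, G) = .id ℝ C(I, G) := by
    have h1 : HasFDerivAt (fun X => f ((0, q), X)) (fderiv ℝ f u₀ ∘L .inr ℝ (ℝ × G) C(I, G)) (c q) :=
      ((hf.differentiable two_ne_zero) u₀).hasFDerivAt.comp (c q)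
        (hasFDerivAt_prodMk_right (0, q) (c q))
    have h2 : HasFDerivAt (fun X => f ((0, q), X)) (.id ℝ C(I, G)) (c q) := by
      simpa [f] using (hasFDerivAt_id (𝕜 := ℝ) (c q)).sub_const (c q)
    exact h1.unique h2
  have hinv : (fderiv ℝ f u₀ ∘L .inr ℝ (ℝ × G) C(I, G)).IsInvertible := by
    rw [hinr]
    exact ContinuousLinearMap.isInvertible_equiv (f := ContinuousLinearEquiv.refl ℝ C(I, G))
  have hfu := hf.contDiffAt (x := u₀)
  refine ⟨hfu.implicitFunction two_ne_zero hinv, hfu.contDiffAt_implicitFunction two_ne_zero hinv,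
    hfu.implicitFunction_apply_self two_ne_zero hinv, ?_⟩
  filter_upwards [hfu.eventually_apply_implicitFunction two_ne_zero hinv] with u hu
  have h0 : f u₀ = 0 := by simp [f, u₀]
  rw [h0] at hu
  change _ - _ - _ = _ at hu
  rwa [sub_sub, sub_eq_zero] at hu

end LocalFlow

section Reachability

variable {G : Type*} [NormedAddCommGroup G] [NormedSpace ℝ G] {d : ℕ}

/-- `y` is reached from `x` by smooth controls vanishing outside of `(0, 1)`. -/
def Reach (W : Fin d → G → G) (x y : G) : Prop :=
  ∃ u : Fin d → ℝ → ℝ, (∀ j, ContDiff ℝ (⊤ : ℕ∞) (u j)) ∧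
    (∀ j t, t ≤ 0 ∨ 1 ≤ t → u j t = 0) ∧
    ∃ X : ℝ → G, (∀ t ≤ 0, X t = x) ∧ (∀ t, 1 ≤ t → X t = y) ∧
      ∀ t, HasDerivAt X (∑ j, u j t • W j (X t)) t

lemma Reach.refl (W : Fin d → G → G) (x : G) : Reach W x x :=
  ⟨fun _ _ => 0, fun _ => contDiff_const, fun _ _ _ => rfl, fun _ => x, fun _ _ => rfl,
    fun _ _ => rfl, fun t => by simpa using hasDerivAt_const t x⟩

lemma Reach.symm {W : Fin d → G → G} {x y : G} (h : Reach W x y) : Reach W y x := by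
  obtain ⟨u, hu, hu0, X, hx, hy, hX⟩ := h
  refine ⟨fun j t => -u j (1 - t), fun j => ?_, fun j t ht => ?_, fun t => X (1 - t),
    fun t ht => hy _ (by linarith), fun t ht => hx _ (by linarith), fun t => ?_⟩
  · exact ((hu j).comp (contDiff_const.sub contDiff_id)).neg
  · dsimp only
    rw [hu0 j (1 - t) (by rcases ht with h | h; right; linarith; left; linarith), neg_zero]
  · have := (hX (1 - t)).scomp t ((hasDerivAt_id t).const_sub 1)
    simpa [Function.comp_def] using this

lemma Reach.trans {W : Fin d → G → G} {x y z : G} (h : Reach W x y) (h' : Reach W y z) :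
    Reach W x z := by
  obtain ⟨u, hu, hu0, X, hx, hy, hX⟩ := h
  obtain ⟨u', hu', hu0', X', hx', hy', hX'⟩ := h'
  refine ⟨fun j t => 2 * u j (2 * t) + 2 * u' j (2 * t - 1), fun j => ?_, fun j t ht => ?_,
    fun t => X (2 * t) + X' (2 * t - 1) - y, fun t ht => ?_, fun t ht => ?_, fun t => ?_⟩
  · exact (contDiff_const.mul ((hu j).comp (contDiff_const.mul contDiff_id))).add
      (contDiff_const.mul ((hu' j).comp ((contDiff_const.mul contDiff_id).sub contDiff_const)))
  · dsimp only
    rcases ht with h | h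
    · rw [hu0 j _ (.inl (by linarith)), hu0' j _ (.inl (by linarith))]; simp
    · rw [hu0 j _ (.inr (by linarith)), hu0' j _ (.inr (by linarith))]; simp
  · dsimp only
    rw [hx _ (by linarith), hx' _ (by linarith), add_sub_cancel_right]
  · dsimp only
    rw [hy _ (by linarith), hy' _ (by linarith), add_sub_cancel_left]
  · have h1 := (hX (2 * t)).scomp t ((hasDerivAt_id t).const_mul 2)
    have h2 := (hX' (2 * t - 1)).scomp t (((hasDerivAt_id t).const_mul 2).sub_const 1)
    refine ((h1.add h2).sub_const y).congr_deriv ?_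
    simp only [mul_one, Finset.smul_sum, smul_smul, add_smul, ← Finset.sum_add_distrib]
    refine Finset.sum_congr rfl fun j _ => ?_
    congr 1
    · rcases le_total (2 * t - 1) 0 with h | h
      · rw [hx' _ h, add_sub_cancel_right]
      · rw [hu0 j _ (.inr (by linarith))]; simp
    · rcases le_total 1 (2 * t) with h | h
      · rw [hy _ h, add_sub_cancel_left]
      · rw [hu0' j _ (.inl (by linarith))]; simp

lemma deriv_smoothTransition_eq_zero {t : ℝ} (ht : t ≤ 0 ∨ 1 ≤ t) :
    deriv Real.smoothTransition t = 0 := by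
  rcases ht with h | h
  · refine IsLocalMin.deriv_eq_zero (Filter.Eventually.of_forall fun s => ?_)
    rw [Real.smoothTransition.zero_of_nonpos h]
    exact Real.smoothTransition.nonneg s
  · refine IsLocalMax.deriv_eq_zero (Filter.Eventually.of_forall fun s => ?_)
    rw [Real.smoothTransition.one_of_one_le h]
    exact Real.smoothTransition.le_one s

/-- A field which is `C²` at a point agrees near that point with a globally `C²` field. -/
lemma exists_contDiff_eventuallyEq [FiniteDimensional ℝ G] {w : G → G} {q : G}
    (hw : ContDiffAt ℝ 2 w q) : ∃ v : C(G, G), ContDiff ℝ 2 v ∧ ∀ᶠ x in 𝓝 q, v x = w x := by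
  obtain ⟨r, hr, hball⟩ := Metric.eventually_nhds_iff_ball.1 (hw.eventually (by simp))
  let f : ContDiffBump q := ⟨r / 4, r / 2, by positivity, by linarith⟩
  have hv : ContDiff ℝ 2 fun x => f x • w x := by
    rw [contDiff_iff_contDiffAt]
    intro x
    by_cases hx : x ∈ Metric.ball q r
    · exact f.contDiffAt.smul (hball x hx)
    · have h0 : x ∉ tsupport f := by
        rw [f.tsupport_eq]
        intro h
        rw [Metric.mem_closedBall] at h
        rw [Metric.mem_ball] at hx
        have : f.rOut = r / 2 := rfl
        linarith
      refine (contDiffAt_const (c := (0 : G))).congr_of_eventuallyEq ?_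
      filter_upwards [notMem_tsupport_iff_eventuallyEq.1 h0] with y hy
      simp [hy]
  refine ⟨⟨_, hv.continuous⟩, hv, ?_⟩
  filter_upwards [f.eventuallyEq_one] with x hx
  simp [hx]

/-- The integral curves of a field `W j`, traversed with a smooth cutoff in time, depend smoothly
on the elapsed time and on the initial value. -/
lemma exists_local_flow [FiniteDimensional ℝ G] (W : Fin d → G → G) (j : Fin d) {q : G}
    (hW : ContDiffAt ℝ 2 (W j) q) :
    ∃ φ : ℝ × G → G, ContDiffAt ℝ 2 φ (0, q) ∧
      (∀ᶠ x in 𝓝 q, φ (0, x) = x ∧ HasDerivAt (fun t => φ (t, x)) (W j x) 0) ∧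
      ∀ᶠ u in 𝓝 ((0 : ℝ), q), Reach W u.2 (φ u) := by
  have : CompleteSpace G := FiniteDimensional.complete ℝ G
  obtain ⟨v, hv, hvW⟩ := exists_contDiff_eventuallyEq hW
  set b : ℝ → ℝ := deriv Real.smoothTransition with hb_def
  have hbs : ContDiff ℝ (⊤ : ℕ∞) b := (Real.smoothTransition.contDiff (n := (⊤ : ℕ∞))).deriv'
  have hb : Continuous b := hbs.continuous
  have hb0 : ∀ {t}, t ≤ 0 ∨ 1 ≤ t → b t = 0 := deriv_smoothTransition_eq_zero
  have hbint : ∫ r in (0 : ℝ)..1, b r = 1 := by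
    rw [intervalIntegral.integral_deriv_eq_sub]
    · simp
    · intro x _
      exact (Real.smoothTransition.contDiff (n := 1)).differentiable one_ne_zero x
    · exact hb.intervalIntegrable _ _
  obtain ⟨Ψ, hΨ, hΨq, hΨeq⟩ := exists_contDiffAt_integral_solution hv (weightedPrimitive hb G) q
  let e : C(I, G) →L[ℝ] G := ContinuousMap.evalCLM ℝ 1
  have hΨ0 : ∀ᶠ x in 𝓝 q, Ψ (0, x) = ContinuousMap.const I x := by
    have : ContinuousAt (fun x : G => ((0 : ℝ), x)) q := by fun_prop
    filter_upwards [this.eventually hΨeq] with x hx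
    simpa using hx
  have hnear : ∀ᶠ u in 𝓝 ((0 : ℝ), q), ∀ s, v (Ψ u s) = W j (Ψ u s) := by
    obtain ⟨r, hr, hball⟩ := Metric.eventually_nhds_iff_ball.1 hvW
    filter_upwards [hΨ.continuousAt (Metric.ball_mem_nhds _ hr)] with u hu s
    have hs : dist (Ψ u s) (Ψ (0, q) s) < r := (ContinuousMap.dist_apply_le_dist s).trans_lt hu
    rw [hΨq] at hs
    exact hball _ hs
  refine ⟨fun u => e (Ψ u), e.contDiff.contDiffAt.comp _ hΨ, ?_, ?_⟩
  · have hdiff : ∀ᶠ u in 𝓝 ((0 : ℝ), q), ContDiffAt ℝ 2 Ψ u := hΨ.eventually (by simp)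
    have hincl : ContinuousAt (fun x : G => ((0 : ℝ), x)) q := by fun_prop
    filter_upwards [hΨ0, hincl.eventually hdiff, hincl.eventually hΨeq.eventually_nhds, hvW]
      with x hx0 hxd hxeq hxW
    refine ⟨by rw [hx0]; rfl, ?_⟩
    have hc : ContinuousAt (fun t : ℝ => ((t, x) : ℝ × G)) 0 := by fun_prop
    have hg : ContinuousAt (fun t : ℝ => e (weightedPrimitive hb G (v.comp (Ψ (t, x))))) 0 := by
      have h1 : ContinuousAt (fun t : ℝ => Ψ (t, x)) 0 :=
        ContinuousAt.comp (f := fun t : ℝ => ((t, x) : ℝ × G)) hxd.continuousAt hc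
      have h2 : Continuous fun Y : C(I, G) => e (weightedPrimitive hb G (v.comp Y)) :=
        e.continuous.comp ((weightedPrimitive hb G).continuous.comp
          (ContinuousMap.continuous_postcomp v))
      exact h2.continuousAt.comp h1
    have hval : e (weightedPrimitive hb G (v.comp (Ψ (0, x)))) = W j x := by
      rw [hx0, ← hxW]
      change weightedPrimitive hb G (v.comp (ContinuousMap.const I x)) 1 = v x
      rw [weightedPrimitive_apply]
      simp [intervalIntegral.integral_smul_const, hbint]
    have heq : (fun t : ℝ => e (Ψ (t, x))) =ᶠ[𝓝 0]
        fun t => x + t • e (weightedPrimitive hb G (v.comp (Ψ (t, x)))) := by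
      filter_upwards [hc.eventually hxeq] with t ht
      conv_lhs => rw [ht]
      rfl
    rw [← hval]
    refine HasDerivAt.congr_of_eventuallyEq ?_ heq
    refine HasDerivAt.const_add x ?_
    rw [hasDerivAt_iff_tendsto_slope]
    refine (hg.tendsto.mono_left nhdsWithin_le_nhds).congr' ?_
    filter_upwards [self_mem_nhdsWithin] with t ht
    simp [slope, smul_smul, inv_mul_cancel₀ (show t ≠ 0 from ht)]
  · filter_upwards [hΨeq, hnear] with u hu hun
    set X : ℝ → G := fun t =>
      u.2 + u.1 • ∫ r in (0 : ℝ)..t, b r • v (Ψ u (projIcc 0 1 zero_le_one r)) with hX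
    have hcont : Continuous fun r => b r • v (Ψ u (projIcc 0 1 zero_le_one r)) := by fun_prop
    have hXI : ∀ s : I, Ψ u s = X s := by
      intro s
      conv_lhs => rw [hu]
      rfl
    refine ⟨fun i t => if i = j then u.1 * b t else 0, fun i => ?_, fun i t ht => ?_, X,
      fun t ht => ?_, fun t ht => ?_, fun t => ?_⟩
    · dsimp only
      split_ifs
      · exact contDiff_const.mul hbs
      · exact contDiff_const
    · simp [hb0 ht]
    · rw [hX]
      dsimp only
      rw [intervalIntegral.integral_zero_ae, smul_zero, add_zero]
      refine Filter.Eventually.of_forall fun r hr => ?_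
      rw [uIoc_of_ge ht] at hr
      rw [hb0 (.inl hr.2), zero_smul]
    · rw [show e (Ψ u) = Ψ u 1 from rfl, hXI, hX]
      dsimp only
      have hz : ∫ r in (1 : ℝ)..t, b r • v (Ψ u (projIcc 0 1 zero_le_one r)) = 0 := by
        refine intervalIntegral.integral_zero_ae (Filter.Eventually.of_forall fun r hr => ?_)
        rw [uIoc_of_le ht] at hr
        rw [hb0 (.inr hr.1.le), zero_smul]
      rw [← intervalIntegral.integral_add_adjacent_intervals (hcont.intervalIntegrable 0 1)
        (hcont.intervalIntegrable 1 t), hz, add_zero]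
      rfl
    · have h1 : HasDerivAt X (u.1 • b t • v (Ψ u (projIcc 0 1 zero_le_one t))) t :=
        ((hcont.integral_hasStrictDerivAt 0 t).hasDerivAt.const_smul u.1).const_add u.2
      refine h1.congr_deriv ?_
      simp only [ite_smul, zero_smul, Finset.sum_ite_eq', Finset.mem_univ, if_true]
      by_cases ht : t ≤ 0 ∨ 1 ≤ t
      · simp [hb0 ht]
      · push Not at ht
        have hp : projIcc (0 : ℝ) 1 zero_le_one t = ⟨t, ht.1.le, ht.2.le⟩ :=
          projIcc_of_mem _ _
        rw [hun, hXI, hp, smul_smul]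

end Reachability

section Orbit

variable {G : Type*} [NormedAddCommGroup G] [NormedSpace ℝ G] {d : ℕ}

/-- `L` is the image of the differential at some parameter of a family of points reached from `p`
which passes through `q`, and some neighbourhood of `p` is moved continuously onto a set containing
`q` along reachable points. -/
def ReachTangent (W : Fin d → G → G) (p q : G) (L : Submodule ℝ G) : Prop :=
  (∃ ψ : G → G, ContinuousAt ψ p ∧ ψ p = q ∧ ∀ᶠ x in 𝓝 p, Reach W x (ψ x)) ∧
  ∃ (P : Type) (_ : NormedAddCommGroup P) (_ : NormedSpace ℝ P) (_ : CompleteSpace P)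
    (f : P → G) (f' : P →L[ℝ] G) (a : P), HasStrictFDerivAt f f' a ∧ f a = q ∧
      (∀ᶠ s in 𝓝 a, Reach W p (f s)) ∧ f'.range = L

lemma ReachTangent.bot (W : Fin d → G → G) (p : G) : ReachTangent W p p ⊥ :=
  ⟨⟨id, continuousAt_id, rfl, .of_forall fun x => .refl W x⟩,
    ℝ, inferInstance, inferInstance, inferInstance, fun _ => p, 0, 0,
    hasStrictFDerivAt_const p 0, rfl, .of_forall fun _ => .refl W p, by ext; simp⟩

lemma ReachTangent.map {W : Fin d → G → G} {p q : G} {L : Submodule ℝ G}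
    (h : ReachTangent W p q L) {φ : G → G} {A : G →L[ℝ] G} (hφ : HasStrictFDerivAt φ A q)
    (hr : ∀ᶠ x in 𝓝 q, Reach W x (φ x)) :
    ReachTangent W p (φ q) (L.map (A : G →ₗ[ℝ] G)) := by
  obtain ⟨⟨ψ, hψ, rfl, hψr⟩, P, _, _, _, f, f', a, hf, hfa, hfr, rfl⟩ := h
  refine ⟨⟨φ ∘ ψ, hφ.continuousAt.comp hψ, rfl, ?_⟩,
    P, inferInstance, inferInstance, inferInstance, φ ∘ f, A ∘L f', a, ?_, ?_, ?_, ?_⟩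
  · filter_upwards [hψr, hψ.eventually hr] with x h1 h2 using h1.trans h2
  · rw [← hfa] at hφ
    exact hφ.comp a hf
  · simp [hfa]
  · have hc := hf.continuousAt
    rw [ContinuousAt, hfa] at hc
    filter_upwards [hfr, hc.eventually hr] with s h1 h2 using h1.trans h2
  · exact LinearMap.range_comp _ _

lemma ReachTangent.extend {W : Fin d → G → G} {p q : G} {L : Submodule ℝ G}
    (h : ReachTangent W p q L) {φ : ℝ × G → G} {A : ℝ × G →L[ℝ] G}
    (hφ : HasStrictFDerivAt φ A (0, q)) (hr : ∀ᶠ u in 𝓝 ((0 : ℝ), q), Reach W u.2 (φ u)) :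
    ReachTangent W p (φ (0, q)) ((Submodule.prod ⊤ L).map (A : ℝ × G →ₗ[ℝ] G)) := by
  obtain ⟨⟨ψ, hψ, rfl, hψr⟩, P, _, _, _, f, f', a, hf, hfa, hfr, rfl⟩ := h
  refine ⟨⟨fun x => φ (0, ψ x), ?_, rfl, ?_⟩,
    ℝ × P, inferInstance, inferInstance, inferInstance, fun u => φ (u.1, f u.2),
    A ∘L (ContinuousLinearMap.id ℝ ℝ).prodMap f', (0, a), ?_, ?_, ?_, ?_⟩
  · exact ContinuousAt.comp (f := fun x => ((0 : ℝ), ψ x)) hφ.continuousAt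
      (continuousAt_const.prodMk hψ)
  · have hc : ContinuousAt (fun x => ((0 : ℝ), ψ x)) p := continuousAt_const.prodMk hψ
    filter_upwards [hψr, hc.eventually hr] with x h1 h2 using h1.trans h2
  · rw [← hfa] at hφ
    exact HasStrictFDerivAt.comp (f := fun u : ℝ × P => (u.1, f u.2)) (0, a) hφ
      ((hasStrictFDerivAt_id _).prodMap (0, a) hf)
  · simp [hfa]
  · have hc : ContinuousAt (fun u : ℝ × P => (u.1, f u.2)) (0, a) :=
      continuousAt_fst.prodMk (ContinuousAt.comp (g := f) hf.continuousAt continuousAt_snd)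
    rw [ContinuousAt] at hc
    dsimp only at hc
    rw [hfa] at hc
    have hs : ContinuousAt (Prod.snd : ℝ × P → P) (0, a) := continuousAt_snd
    filter_upwards [hs.eventually hfr, hc.eventually hr] with s h1 h2 using h1.trans h2
  · ext y
    simp only [LinearMap.mem_range, Submodule.mem_map, Submodule.mem_prod]
    constructor
    · rintro ⟨u, rfl⟩
      exact ⟨(u.1, f' u.2), ⟨trivial, u.2, rfl⟩, rfl⟩
    · rintro ⟨⟨t, w⟩, ⟨-, s, rfl⟩, rfl⟩
      exact ⟨(t, s), rfl⟩

lemma ReachTangent.reach_mem_nhds [CompleteSpace G] {W : Fin d → G → G} {p q : G}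
    (h : ReachTangent W p q ⊤) : ∀ᶠ x in 𝓝 p, Reach W p x := by
  obtain ⟨⟨ψ, hψ, hψq, hψr⟩, P, _, _, _, f, f', a, hf, hfa, hfr, hL⟩ := h
  have hmap := hf.map_nhds_eq_of_surj hL
  have hq : ∀ᶠ y in 𝓝 (ψ p), Reach W p y := by
    rw [hψq, ← hfa, ← hmap]
    exact hfr
  filter_upwards [hψr, hψ.eventually hq] with x h1 h2 using h2.trans h1.symm

lemma HasDerivAt.mem_submodule_of_eventually_mem [FiniteDimensional ℝ G] {L : Submodule ℝ G}
    {g : ℝ → G} {g' : G} {t₀ : ℝ} (hg : HasDerivAt g g' t₀) (h : ∀ᶠ t in 𝓝 t₀, g t ∈ L) :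
    g' ∈ L := by
  refine L.closed_of_finiteDimensional.mem_of_tendsto (hasDerivAt_iff_tendsto_slope.1 hg) ?_
  filter_upwards [h.filter_mono nhdsWithin_le_nhds] with t ht
  exact L.smul_mem _ (L.sub_mem ht h.self_of_nhds)

/-- The Lie algebra generated by `W`, with fields identified when they agree on `D`. -/
inductive LieOn {G : Type*} [NormedAddCommGroup G] [NormedSpace ℝ G] {d : ℕ}
    (W : Fin d → G → G) (D : Set G) : (G → G) → Prop
  | gen (j : Fin d) : LieOn W D (W j)
  | zero : LieOn W D 0
  | add {Y Z : G → G} : LieOn W D Y → LieOn W D Z → LieOn W D (Y + Z)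
  | smul (c : ℝ) {Y : G → G} : LieOn W D Y → LieOn W D (c • Y)
  | bracket {Y Z : G → G} : LieOn W D Y → LieOn W D Z → LieOn W D (lieBracketVF Y Z)
  | congr {Y Z : G → G} : LieOn W D Y → EqOn Y Z D → LieOn W D Z

lemma lieBracketVF_eq (U V : G → G) : lieBracketVF U V = VectorField.lieBracket ℝ U V := rfl

lemma AnalyticOnNhd.lieBracketVF [CompleteSpace G] {U V : G → G} {D : Set G}
    (hU : AnalyticOnNhd ℝ U D) (hV : AnalyticOnNhd ℝ V D) :
    AnalyticOnNhd ℝ (_root_.lieBracketVF U V) D := fun x hx =>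
  (((ContinuousLinearMap.id ℝ (G →L[ℝ] G)).analyticAt_bilinear _).comp₂
    (hV.fderiv x hx) (hU x hx)).sub
  (((ContinuousLinearMap.id ℝ (G →L[ℝ] G)).analyticAt_bilinear _).comp₂
    (hU.fderiv x hx) (hV x hx))

/-- A field is tangent at every family of maximal rank. -/
def TangentToMaximal (W : Fin d → G → G) (D : Set G) (p : G) (r : ℕ) (Y : G → G) : Prop :=
  ∀ q ∈ D, ∀ L : Submodule ℝ G, ReachTangent W p q L → Module.finrank ℝ L = r → Y q ∈ L

variable [FiniteDimensional ℝ G] {W : Fin d → G → G} {D : Set G} {p : G} {r : ℕ}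

lemma tangentToMaximal_gen (hW : ∀ j, AnalyticOnNhd ℝ (W j) D)
    (hmax : ∀ q ∈ D, ∀ L, ReachTangent W p q L → Module.finrank ℝ L ≤ r) (j : Fin d) :
    TangentToMaximal W D p r (W j) := by
  intro q hq L hL hr
  obtain ⟨φ, hφ, hφ0, hφr⟩ := exists_local_flow W j (hW j q hq).contDiffAt
  have hs := hφ.hasStrictFDerivAt two_ne_zero
  have hext := hL.extend hs hφr
  rw [hφ0.self_of_nhds.1] at hext
  have hinr : ∀ w, fderiv ℝ φ (0, q) (0, w) = w := by
    have h1 := hs.hasFDerivAt.comp q (hasFDerivAt_prodMk_right (0 : ℝ) q)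
    have h2 := (hasFDerivAt_id (𝕜 := ℝ) q).congr_of_eventuallyEq
      (f₁ := fun x => φ (0, x)) (hφ0.mono fun x hx => hx.1)
    intro w
    simpa using congrArg (fun T : G →L[ℝ] G => T w) (h1.unique h2)
  have hinl : fderiv ℝ φ (0, q) (1, 0) = W j q := by
    have h1 := (hs.hasFDerivAt.comp (0 : ℝ) (hasFDerivAt_prodMk_left (0 : ℝ) q)).hasDerivAt
    simpa using h1.unique hφ0.self_of_nhds.2
  have hle : L ≤ (Submodule.prod ⊤ L).map (fderiv ℝ φ (0, q) : ℝ × G →ₗ[ℝ] G) := fun w hw =>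
    ⟨(0, w), ⟨trivial, hw⟩, hinr w⟩
  rw [Submodule.eq_of_le_of_finrank_le hle ((hmax q hq _ hext).trans hr.ge)]
  exact ⟨(1, 0), ⟨trivial, L.zero_mem⟩, hinl⟩

lemma tangentToMaximal_bracket_gen (hD : IsOpen D) (hW : ∀ j, AnalyticOnNhd ℝ (W j) D) (j : Fin d)
    {Y : G → G} (hYa : AnalyticOnNhd ℝ Y D) (hY : TangentToMaximal W D p r Y) :
    TangentToMaximal W D p r (lieBracketVF (W j) Y) := by
  intro q hq L hL hr
  have : CompleteSpace G := FiniteDimensional.complete ℝ G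
  obtain ⟨φ, hφ, hφ0, hφr⟩ := exists_local_flow W j (hW j q hq).contDiffAt
  have hq0 := hφ0.self_of_nhds.1
  have hc : ContinuousAt (fun t : ℝ => (t, q)) 0 := by fun_prop
  set A : ℝ → G →L[ℝ] G := fun t => fderiv ℝ φ (t, q) ∘L .inr ℝ ℝ G with hA
  have hd2 : HasFDerivAt (fderiv ℝ φ) (fderiv ℝ (fderiv ℝ φ) (0, q)) (0, q) :=
    ((hφ.fderiv_right (m := 1) (by norm_num)).differentiableAt one_ne_zero).hasFDerivAt
  have hA0 : A 0 = 1 := by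
    have h1 := (hφ.differentiableAt two_ne_zero).hasFDerivAt.comp q
      (hasFDerivAt_prodMk_right (0 : ℝ) q)
    have h2 := (hasFDerivAt_id (𝕜 := ℝ) q).congr_of_eventuallyEq
      (f₁ := fun x => φ (0, x)) (hφ0.mono fun x hx => hx.1)
    exact h1.unique h2
  have hAd : HasDerivAt A (fderiv ℝ (W j) q) 0 := by
    have h1 : HasDerivAt (fun t : ℝ => fderiv ℝ φ (t, q))
        (fderiv ℝ (fderiv ℝ φ) (0, q) (1, 0)) 0 := by
      exact hd2.comp_hasDerivAt (0 : ℝ)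
        ((hasDerivAt_id (0 : ℝ)).prodMk (hasDerivAt_const (0 : ℝ) q))
    have h2 : HasDerivAt A (fderiv ℝ (fderiv ℝ φ) (0, q) (1, 0) ∘L .inr ℝ ℝ G) 0 :=
      (((ContinuousLinearMap.compL ℝ G (ℝ × G) G).flip (.inr ℝ ℝ G)).hasFDerivAt).comp_hasDerivAt
        (0 : ℝ) h1
    refine h2.congr_deriv ?_
    have h3 : HasFDerivAt (fun x => fderiv ℝ φ (0, x) (1, 0))
        ((fderiv ℝ (fderiv ℝ φ) (0, q) ∘L .inr ℝ ℝ G).flip (1, 0)) q :=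
      ((ContinuousLinearMap.apply ℝ G ((1 : ℝ), (0 : G))).hasFDerivAt).comp q
        (hd2.comp q (hasFDerivAt_prodMk_right (0 : ℝ) q))
    have hdiff : ∀ᶠ x in 𝓝 q, DifferentiableAt ℝ φ (0, x) := by
      have hc' : ContinuousAt (fun x : G => ((0 : ℝ), x)) q := by fun_prop
      filter_upwards [hc'.eventually (hφ.eventually (by simp))] with x hx
      exact hx.differentiableAt two_ne_zero
    have h4 : HasFDerivAt (W j) ((fderiv ℝ (fderiv ℝ φ) (0, q) ∘L .inr ℝ ℝ G).flip (1, 0)) q := by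
      refine h3.congr_of_eventuallyEq ?_
      filter_upwards [hφ0, hdiff] with x hx hxd
      have := (hxd.hasFDerivAt.comp (0 : ℝ) (hasFDerivAt_prodMk_left (0 : ℝ) x)).hasDerivAt
      simpa using hx.2.unique this
    rw [h4.fderiv]
    ext w
    have hsymm : IsSymmSndFDerivAt ℝ φ (0, q) := hφ.isSymmSndFDerivAt (by simp)
    exact hsymm (1, 0) (0, w)
  have hmem : ∀ᶠ t in 𝓝 (0 : ℝ), Ring.inverse (A t) (Y (φ (t, q))) ∈ L := by
    have hunit : ∀ᶠ t in 𝓝 (0 : ℝ), IsUnit (A t) := by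
      refine hAd.continuousAt.eventually (Units.isOpen.mem_nhds ?_)
      rw [hA0]
      exact isUnit_one
    have hφD : ∀ᶠ t in 𝓝 (0 : ℝ), φ (t, q) ∈ D := by
      refine (ContinuousAt.comp (f := fun t : ℝ => (t, q)) hφ.continuousAt hc).eventually
        (hD.mem_nhds ?_)
      rwa [Function.comp_apply, hq0]
    filter_upwards [hunit, hφD, hc.eventually (hφ.eventually (by simp)),
      hc.eventually hφr.eventually_nhds] with t ht htD htd htr
    have hs : HasStrictFDerivAt (fun x => φ (t, x)) (A t) q :=
      (htd.hasStrictFDerivAt two_ne_zero).comp q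
        ((hasStrictFDerivAt_const t q).prodMk (hasStrictFDerivAt_id q))
    have hc' : ContinuousAt (fun x : G => (t, x)) q := by fun_prop
    have hinv : Ring.inverse (A t) * A t = 1 := Ring.inverse_mul_cancel _ ht
    have hinj : Function.Injective (A t) := by
      intro x y hxy
      have h1 : ∀ v, Ring.inverse (A t) (A t v) = v := fun v =>
        congrArg (fun T : G →L[ℝ] G => T v) hinv
      rw [← h1 x, hxy, h1]
    have hmap := hY _ htD _ (hL.map hs (hc'.eventually htr))
      ((Submodule.equivMapOfInjective (A t : G →ₗ[ℝ] G) hinj L).finrank_eq.symm.trans hr)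
    obtain ⟨w, hw, hwe⟩ := hmap
    rw [← hwe]
    change (Ring.inverse (A t) * A t) w ∈ L
    rw [hinv]
    exact hw
  refine HasDerivAt.mem_submodule_of_eventually_mem (t₀ := 0) ?_ hmem
  have hinvd : HasDerivAt (fun t => Ring.inverse (A t)) (-fderiv ℝ (W j) q) 0 := by
    have h1 := hasFDerivAt_ringInverse (𝕜 := ℝ) (1 : (G →L[ℝ] G)ˣ)
    rw [Units.val_one, ← hA0] at h1
    refine (h1.comp_hasDerivAt (0 : ℝ) hAd).congr_deriv ?_
    ext
    simp
  have hφt : HasDerivAt (fun t => Y (φ (t, q))) (fderiv ℝ Y q (W j q)) 0 := by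
    have h1 := (hYa q hq).differentiableAt.hasFDerivAt
    rw [← hq0] at h1
    have := h1.comp_hasDerivAt (0 : ℝ) hφ0.self_of_nhds.2
    rwa [hq0] at this
  refine (hinvd.clm_apply hφt).congr_deriv ?_
  simp [hA0, hq0, lieBracketVF, sub_eq_neg_add]

end Orbit

section Chow

variable {G : Type*} [NormedAddCommGroup G] [NormedSpace ℝ G] [FiniteDimensional ℝ G] {d : ℕ}
  {W : Fin d → G → G} {D : Set G} {p : G} {r : ℕ}

/-- The analytic fields tangent at every family of maximal rank which also normalize the space of
all such fields. -/
def NormalizesTangent (W : Fin d → G → G) (D : Set G) (p : G) (r : ℕ) (Y : G → G) : Prop :=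
  AnalyticOnNhd ℝ Y D ∧ TangentToMaximal W D p r Y ∧
    ∀ Z, AnalyticOnNhd ℝ Z D → TangentToMaximal W D p r Z →
      TangentToMaximal W D p r (lieBracketVF Y Z)

lemma LieOn.normalizesTangent (hD : IsOpen D) (hW : ∀ j, AnalyticOnNhd ℝ (W j) D)
    (hmax : ∀ q ∈ D, ∀ L, ReachTangent W p q L → Module.finrank ℝ L ≤ r) {Y : G → G}
    (hY : LieOn W D Y) : NormalizesTangent W D p r Y := by
  have : CompleteSpace G := FiniteDimensional.complete ℝ G
  induction hY with
  | gen j => exact ⟨hW j, tangentToMaximal_gen hW hmax j, fun Z hZ hZt =>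
      tangentToMaximal_bracket_gen hD hW j hZ hZt⟩
  | zero =>
    refine ⟨analyticOnNhd_const, fun _ _ L _ _ => L.zero_mem, fun Z _ _ q _ L _ _ => ?_⟩
    rw [lieBracketVF_eq, VectorField.lieBracket_zero_left]
    exact L.zero_mem
  | @add Y Z _ _ hY hZ =>
    refine ⟨hY.1.add hZ.1, fun q hq L hL hr => L.add_mem (hY.2.1 q hq L hL hr)
      (hZ.2.1 q hq L hL hr), fun X hX hXt q hq L hL hr => ?_⟩
    rw [lieBracketVF_eq, VectorField.lieBracket_add_left (hY.1 q hq).differentiableAt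
      (hZ.1 q hq).differentiableAt]
    exact L.add_mem (hY.2.2 X hX hXt q hq L hL hr) (hZ.2.2 X hX hXt q hq L hL hr)
  | @smul c Y _ hY =>
    refine ⟨hY.1.const_smul, fun q hq L hL hr => L.smul_mem c (hY.2.1 q hq L hL hr),
      fun X hX hXt q hq L hL hr => ?_⟩
    rw [lieBracketVF_eq, VectorField.lieBracket_const_smul_left (hY.1 q hq).differentiableAt]
    exact L.smul_mem c (hY.2.2 X hX hXt q hq L hL hr)
  | @bracket Y Z _ _ hY hZ =>
    refine ⟨hY.1.lieBracketVF hZ.1, hY.2.2 Z hZ.1 hZ.2.1, fun X hX hXt q hq L hL hr => ?_⟩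
    have hjac := VectorField.leibniz_identity_lieBracket (n := 2) (by simp)
      (hY.1 q hq).contDiffAt (hZ.1 q hq).contDiffAt (hX q hq).contDiffAt
    have h1 := hY.2.2 _ (hZ.1.lieBracketVF hX) (hZ.2.2 X hX hXt) q hq L hL hr
    have h2 := hZ.2.2 _ (hY.1.lieBracketVF hX) (hY.2.2 X hX hXt) q hq L hL hr
    have h3 := L.sub_mem h1 h2
    simp only [lieBracketVF_eq] at h3 ⊢
    rwa [hjac, add_sub_cancel_right] at h3
  | @congr Y Z _ h hY =>
    refine ⟨hY.1.congr hD h, fun q hq L hL hr => h hq ▸ hY.2.1 q hq L hL hr,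
      fun X hX hXt q hq L hL hr => ?_⟩
    have he : Z =ᶠ[𝓝 q] Y := (h.symm).eventuallyEq_of_mem (hD.mem_nhds hq)
    have := hY.2.2 X hX hXt q hq L hL hr
    rwa [lieBracketVF, ← he.fderiv_eq, ← he.self_of_nhds] at this

/-- A **Chow–Rashevskii theorem**: bracket-generating fields reach a neighbourhood. -/
theorem eventually_reach (hD : IsOpen D) (hp : p ∈ D) (hW : ∀ j, AnalyticOnNhd ℝ (W j) D)
    (hspan : ∀ q ∈ D, Submodule.span ℝ {w | ∃ Y, LieOn W D Y ∧ Y q = w} = ⊤) :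
    ∀ᶠ x in 𝓝 p, Reach W p x := by
  set S : Set ℕ := {n | ∃ q ∈ D, ∃ L, ReachTangent W p q L ∧ Module.finrank ℝ L = n} with hS
  have hne : S.Nonempty := ⟨_, p, hp, ⊥, ReachTangent.bot W p, rfl⟩
  have hbdd : BddAbove S := ⟨Module.finrank ℝ G, by
    rintro n ⟨q, -, L, -, rfl⟩
    exact L.finrank_le⟩
  obtain ⟨q, hq, L, hL, hr⟩ := Nat.sSup_mem hne hbdd
  have htop : L = ⊤ := by
    rw [eq_top_iff, ← hspan q hq, Submodule.span_le]
    rintro _ ⟨Y, hY, rfl⟩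
    exact (hY.normalizesTangent hD hW fun q hq L hL => le_csSup hbdd ⟨q, hq, L, hL, rfl⟩).2.1
      q hq L hL hr
  have : CompleteSpace G := FiniteDimensional.complete ℝ G
  rw [htop] at hL
  exact hL.reach_mem_nhds

end Chow

section ParametricFields

variable {E Z : Type*} [NormedAddCommGroup E] [NormedSpace ℝ E] {d N : ℕ}

/-- The Lie algebra generated by parametrized fields, with brackets taken in the first variable. -/
inductive ParamLie {E Z : Type*} [NormedAddCommGroup E] [NormedSpace ℝ E] {d : ℕ}
    (V : Fin d → E × Z → E) : (E × Z → E) → Prop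
  | gen (j : Fin d) : ParamLie V (V j)
  | zero : ParamLie V 0
  | add {F H : E × Z → E} : ParamLie V F → ParamLie V H → ParamLie V (F + H)
  | smul (c : ℝ) {F : E × Z → E} : ParamLie V F → ParamLie V (c • F)
  | bracket {F H : E × Z → E} : ParamLie V F → ParamLie V H →
      ParamLie V fun u => lieBracketVF (fun x => F (x, u.2)) (fun x => H (x, u.2)) u.1

lemma exists_paramLie_of_mem_lieGen {V : Fin d → E × Z → E} {z : Z} {P : E → E}
    (hP : P ∈ lieGen (range fun j x => V j (x, z))) :
    ∃ F, ParamLie V F ∧ ∀ x, F (x, z) = P x := by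
  refine hP {P | ∃ F, ParamLie V F ∧ ∀ x, F (x, z) = P x} ⟨?_, ⟨0, .zero, fun _ => rfl⟩, ?_, ?_, ?_⟩
  · rintro _ ⟨j, rfl⟩
    exact ⟨V j, .gen j, fun _ => rfl⟩
  · rintro _ _ ⟨F, hF, hf⟩ ⟨H, hH, hh⟩
    exact ⟨F + H, hF.add hH, fun x => congrArg₂ _ (hf x) (hh x)⟩
  · rintro c _ ⟨F, hF, hf⟩
    exact ⟨c • F, hF.smul c, fun x => congrArg _ (hf x)⟩
  · rintro f h ⟨F, hF, hf⟩ ⟨H, hH, hh⟩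
    refine ⟨_, hF.bracket hH, fun x => ?_⟩
    obtain rfl : (fun x => F (x, z)) = f := funext hf
    obtain rfl : (fun x => H (x, z)) = h := funext hh
    rfl

variable [NormedAddCommGroup Z] [NormedSpace ℝ Z] {V : Fin d → E × Z → E} {U : Set (E × Z)}

lemma DifferentiableAt.hasFDerivAt_partial_fst {F : E × Z → E} {u : E × Z}
    (hF : DifferentiableAt ℝ F u) :
    HasFDerivAt (fun x => F (x, u.2)) (fderiv ℝ F u ∘L .inl ℝ E Z) u.1 :=
  HasFDerivAt.comp (g := F) u.1 hF.hasFDerivAt (hasFDerivAt_prodMk_left u.1 u.2)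

lemma ParamLie.analyticOnNhd [CompleteSpace E] (hU : IsOpen U)
    (hV : ∀ j, AnalyticOnNhd ℝ (V j) U) {F : E × Z → E} (hF : ParamLie V F) :
    AnalyticOnNhd ℝ F U := by
  induction hF with
  | gen j => exact hV j
  | zero => exact analyticOnNhd_const
  | add _ _ hF hH => exact hF.add hH
  | smul c _ hF => exact hF.const_smul
  | @bracket F H _ _ hF hH =>
    have hclm : ∀ {A B : E × Z → E}, AnalyticOnNhd ℝ A U → AnalyticOnNhd ℝ B U →
        AnalyticOnNhd ℝ (fun u => fderiv ℝ A u (B u, 0)) U := fun {A B} hA hB u hu =>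
      ((ContinuousLinearMap.id ℝ (E × Z →L[ℝ] E)).analyticAt_bilinear _).comp₂
        (hA.fderiv u hu) ((hB u hu).prod analyticAt_const)
    refine AnalyticOnNhd.congr hU ((hclm hH hF).sub (hclm hF hH)) fun u hu => ?_
    simp [lieBracketVF, (hF u hu).differentiableAt.hasFDerivAt_partial_fst.fderiv,
      (hH u hu).differentiableAt.hasFDerivAt_partial_fst.fderiv]

/-- The field acting by the same parametrized field on every point of a tuple. -/
def tupleField (N : ℕ) (F : E × Z → E) (z : Z) : (Fin N → E) → Fin N → E :=
  fun x i => F (x i, z)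

lemma hasFDerivAt_tupleField {F : E × Z → E} {z : Z} {x : Fin N → E}
    (hF : ∀ i, DifferentiableAt ℝ F (x i, z)) :
    HasFDerivAt (tupleField N F z) (.pi fun i =>
      fderiv ℝ (fun y => F (y, z)) (x i) ∘L .proj (R := ℝ) (φ := fun _ : Fin N => E) i) x :=
  hasFDerivAt_pi.2 fun i => HasFDerivAt.comp (g := fun y => F (y, z)) x
    (hF i).hasFDerivAt_partial_fst.differentiableAt.hasFDerivAt (hasFDerivAt_apply i x)

lemma analyticOnNhd_tupleField {F : E × Z → E} (hF : AnalyticOnNhd ℝ F U) (z : Z) :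
    AnalyticOnNhd ℝ (tupleField N F z) {x | ∀ i, (x i, z) ∈ U} := fun x hx =>
  AnalyticAt.pi fun i => AnalyticAt.comp (g := F) (hF _ (hx i))
    ((((ContinuousLinearMap.proj (R := ℝ) (φ := fun _ : Fin N => E) i).analyticAt x)).prod
      analyticAt_const)

lemma ParamLie.lieOn_tupleField [CompleteSpace E] (hU : IsOpen U)
    (hV : ∀ j, AnalyticOnNhd ℝ (V j) U) {F : E × Z → E} (hF : ParamLie V F) {z : Z}
    {D : Set (Fin N → E)} (hD : ∀ x ∈ D, ∀ i, (x i, z) ∈ U) :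
    LieOn (fun j => tupleField N (V j) z) D (tupleField N F z) := by
  induction hF with
  | gen j => exact LieOn.gen (W := fun j => tupleField N (V j) z) j
  | zero => exact .zero
  | add _ _ hF hH => exact hF.add hH
  | smul c _ hF => exact hF.smul c
  | @bracket F H hFp hHp hF hH =>
    refine (hF.bracket hH).congr fun x hx => ?_
    have hd : ∀ {A : E × Z → E}, ParamLie V A → ∀ i, DifferentiableAt ℝ A (x i, z) :=
      fun hA i => (hA.analyticOnNhd hU hV _ (hD x hx i)).differentiableAt
    ext1 i
    simp [lieBracketVF, (hasFDerivAt_tupleField (hd hFp)).fderiv,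
      (hasFDerivAt_tupleField (hd hHp)).fderiv, tupleField]

end ParametricFields

section ZeroSets

lemma volume_zeros_eq_zero_of_analyticOnNhd {h : ℝ → ℝ} {T : Set ℝ} (hh : AnalyticOnNhd ℝ h T)
    (hTo : IsOpen T) (hT : IsPreconnected T) {t₀ : ℝ} (ht₀ : t₀ ∈ T) (hne : h t₀ ≠ 0) :
    volume {t | t ∈ T ∧ h t = 0} = 0 := by
  rcases hh.eqOn_zero_or_eventually_ne_zero_of_preconnected hT with h0 | h0
  · exact absurd (h0 ht₀) hne
  · have h1 : ∀ᵐ t ∂volume.restrict T, h t ≠ 0 :=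
      ae_restrict_le_codiscreteWithin hTo.measurableSet h0
    have h2 := (ae_restrict_iff' hTo.measurableSet).1 h1
    rw [ae_iff] at h2
    simpa using h2

variable {G : Type*} [NormedAddCommGroup G] [NormedSpace ℝ G] [FiniteDimensional ℝ G]
  [MeasurableSpace G] [BorelSpace G] (μ : Measure G) [μ.IsAddHaarMeasure] {f : G → ℝ} {D : Set G}

lemma measure_zeros_eq_zero_of_convex (hf : AnalyticOnNhd ℝ f D) (hDo : IsOpen D)
    (hD : Convex ℝ D) {b : G} (hb : b ∈ D) (hne : f b ≠ 0) : μ {x | x ∈ D ∧ f x = 0} = 0 := by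
  set S : Set G := {x | x ∈ D ∧ f x = 0} with hS
  have hSm : MeasurableSet S := by
    have : S = D \ (D ∩ f ⁻¹' {0}ᶜ) := by
      ext x
      simp only [hS, mem_ofPred_eq, mem_sdiff, mem_inter_iff, mem_preimage, mem_compl_iff,
        mem_singleton_iff]
      tauto
    rw [this]
    exact hDo.measurableSet.diff
      (hf.continuousOn.isOpen_inter_preimage hDo isOpen_compl_singleton).measurableSet
  have hline : ∀ x : G, AnalyticOnNhd ℝ (fun t : ℝ => AffineMap.lineMap (k := ℝ) b x t) univ := by
    intro x t _
    simp only [AffineMap.lineMap_apply, vsub_eq_sub, vadd_eq_add]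
    fun_prop
  have hsec : ∀ x, ∀ᵐ t : ℝ, AffineMap.lineMap (k := ℝ) b x t ∉ S := by
    intro x
    have hcont : Continuous (fun t : ℝ => AffineMap.lineMap (k := ℝ) b x t) :=
      AffineMap.lineMap_continuous
    have := volume_zeros_eq_zero_of_analyticOnNhd (h := fun t => f (AffineMap.lineMap b x t))
      (T := AffineMap.lineMap b x ⁻¹' D)
      (fun t ht => AnalyticAt.comp (g := f) (hf _ ht) (hline x t trivial))
      (hDo.preimage hcont) (hD.affine_preimage (AffineMap.lineMap b x)).isPreconnected (t₀ := 0)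
      (by simpa using hb) (by simpa using hne)
    rw [ae_iff]
    simpa [hS] using this
  have hmeas : MeasurableSet {u : G × ℝ | AffineMap.lineMap (k := ℝ) b u.1 u.2 ∉ S} := by
    have hc : Continuous fun u : G × ℝ => AffineMap.lineMap (k := ℝ) b u.1 u.2 := by
      simp only [AffineMap.lineMap_apply, vsub_eq_sub, vadd_eq_add]
      fun_prop
    exact hc.measurable hSm.compl
  have hae : ∀ᵐ t : ℝ, ∀ᵐ x ∂μ, AffineMap.lineMap (k := ℝ) b x t ∉ S :=
    (Measure.ae_ae_comm hmeas).1 (.of_forall hsec)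
  obtain ⟨t, ht, ht0⟩ := (hae.and (compl_mem_ae_iff.2 (measure_singleton (0 : ℝ)))).exists
  rw [ae_iff] at ht
  have himage : S ⊆ AffineMap.homothety b t '' {x | ¬AffineMap.lineMap (k := ℝ) b x t ∉ S} := by
    intro x hx
    have hxe : AffineMap.lineMap (k := ℝ) b (AffineMap.homothety b t⁻¹ x) t = x := by
      simp [AffineMap.lineMap_apply, AffineMap.homothety_apply, smul_smul,
        mul_inv_cancel₀ (show t ≠ 0 from ht0)]
    exact ⟨AffineMap.homothety b t⁻¹ x, not_not.2 (hxe.symm ▸ hx), hxe⟩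
  refine measure_mono_null himage ?_
  rw [Measure.addHaar_image_homothety, ht, mul_zero]

/-- The zero set of a nontrivial real analytic function is null. -/
theorem measure_zeros_eq_zero (hf : AnalyticOnNhd ℝ f D) (hDo : IsOpen D)
    (hD : IsPreconnected D) {b : G} (hb : b ∈ D) (hne : f b ≠ 0) :
    μ {x | x ∈ D ∧ f x = 0} = 0 := by
  have : ProperSpace G := FiniteDimensional.proper ℝ G
  refine measure_null_of_locally_null _ fun x hx => ?_
  obtain ⟨ε, hε, hball⟩ := Metric.isOpen_iff.1 hDo x hx.1
  have hex : ∃ c ∈ Metric.ball x ε, f c ≠ 0 := by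
    by_contra! h
    exact hne (hf.eqOn_zero_of_preconnected_of_eventuallyEq_zero hD hx.1
      (Filter.eventuallyEq_of_mem (Metric.ball_mem_nhds x hε) h) hb)
  obtain ⟨c, hc, hfc⟩ := hex
  refine ⟨_, ?_, measure_zeros_eq_zero_of_convex μ (hf.mono hball) Metric.isOpen_ball
    (convex_ball x ε) hc hfc⟩
  filter_upwards [self_mem_nhdsWithin, mem_nhdsWithin_of_mem_nhds (Metric.ball_mem_nhds x hε)]
    with y hy hyb using ⟨hyb, hy.2⟩

end ZeroSets

section Interpolation

variable {m l d N : ℕ}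

lemma exists_isPolyVF_eq_single {x : Fin N → EuclideanSpace ℝ (Fin m)} (hx : Function.Injective x)
    (a : Fin N × Fin m) : ∃ P, IsPolyVF P ∧
      ∀ b : Fin N × Fin m, P (x b.1) b.2 = (1 : Matrix (Fin N × Fin m) (Fin N × Fin m) ℝ) a b := by
  classical
  set s : MvPolynomial (Fin m) ℝ := ∏ i ∈ Finset.univ.erase a.1,
    ∑ k, (MvPolynomial.X k - MvPolynomial.C (x i k)) ^ 2 with hs
  have heval : ∀ y : EuclideanSpace ℝ (Fin m), MvPolynomial.eval (fun k => y k) s =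
      ∏ i ∈ Finset.univ.erase a.1, ‖y - x i‖ ^ 2 := fun y => by
    simp [hs, EuclideanSpace.real_norm_sq_eq]
  set p : Fin m → MvPolynomial (Fin m) ℝ := fun j =>
    if a.2 = j then MvPolynomial.C (∏ i ∈ Finset.univ.erase a.1, ‖x a.1 - x i‖ ^ 2)⁻¹ * s else 0
    with hp
  refine ⟨fun y => WithLp.toLp 2 fun j => MvPolynomial.eval (fun k => y k) (p j),
    ⟨p, fun _ _ => rfl⟩, fun b => ?_⟩
  obtain ⟨i, k⟩ := a
  obtain ⟨i', k'⟩ := b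
  dsimp only at hp heval ⊢
  rw [hp, Matrix.one_apply]
  by_cases hk : k = k'
  · by_cases hi : i = i'
    · subst hi hk
      have hne : ∏ j ∈ Finset.univ.erase i, ‖x i - x j‖ ^ 2 ≠ 0 :=
        Finset.prod_ne_zero_iff.2 fun j hj => pow_ne_zero 2 <| norm_ne_zero_iff.2 <|
          sub_ne_zero.2 fun h => (Finset.ne_of_mem_erase hj) (hx h).symm
      simp [heval, inv_mul_cancel₀ hne]
    · have h0 : ∏ j ∈ Finset.univ.erase i, ‖x i' - x j‖ ^ 2 = 0 :=
        Finset.prod_eq_zero (Finset.mem_erase.2 ⟨Ne.symm hi, Finset.mem_univ i'⟩) (by simp)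
      simp [hk, hi, heval, h0]
  · simp [hk]

/-- The matrix of values of a family of parametrized fields at the points of a tuple. -/
def valueMatrix (F : Fin N × Fin m → EuclideanSpace ℝ (Fin m) × EuclideanSpace ℝ (Fin l) →
      EuclideanSpace ℝ (Fin m))
    (u : (Fin N → EuclideanSpace ℝ (Fin m)) × EuclideanSpace ℝ (Fin l)) :
    Matrix (Fin N × Fin m) (Fin N × Fin m) ℝ :=
  .of fun a b => F a (u.1 b.1, u.2) b.2

variable {F : Fin N × Fin m → EuclideanSpace ℝ (Fin m) × EuclideanSpace ℝ (Fin l) →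
  EuclideanSpace ℝ (Fin m)} {U : Set (EuclideanSpace ℝ (Fin m) × EuclideanSpace ℝ (Fin l))}

lemma analyticOnNhd_det_valueMatrix (hF : ∀ a, AnalyticOnNhd ℝ (F a) U) :
    AnalyticOnNhd ℝ (fun u => (valueMatrix F u).det) {u | ∀ i, (u.1 i, u.2) ∈ U} := by
  intro u hu
  simp only [Matrix.det_apply, valueMatrix, Matrix.of_apply]
  refine Finset.analyticAt_fun_sum _ fun e _ => ?_
  simp only [Units.smul_def, ← Int.cast_smul_eq_zsmul ℝ]
  refine analyticAt_const.fun_smul (Finset.analyticAt_fun_prod _ fun b _ => ?_)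
  have h1 : AnalyticAt ℝ (fun u : (Fin N → EuclideanSpace ℝ (Fin m)) × EuclideanSpace ℝ (Fin l) =>
      (u.1 b.1, u.2)) u :=
    (((ContinuousLinearMap.proj (R := ℝ) (φ := fun _ : Fin N => EuclideanSpace ℝ (Fin m)) b.1).comp
      (.fst ℝ _ _)).analyticAt u).prod analyticAt_snd
  exact ((EuclideanSpace.proj b.2 : EuclideanSpace ℝ (Fin m) →L[ℝ] ℝ).analyticAt _).comp
    (AnalyticAt.comp (g := F (e b)) (hF _ _ (hu b.1)) h1)

lemma span_tupleField_eq_top {x : Fin N → EuclideanSpace ℝ (Fin m)}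
    {z : EuclideanSpace ℝ (Fin l)} (hdet : (valueMatrix F (x, z)).det ≠ 0) :
    Submodule.span ℝ (range fun a => tupleField N (F a) z x) = ⊤ := by
  rw [eq_top_iff]
  rintro v -
  set c : Fin N × Fin m → ℝ := Matrix.vecMul (fun b => v b.1 b.2) (valueMatrix F (x, z))⁻¹ with hc
  have hcv : Matrix.vecMul c (valueMatrix F (x, z)) = fun b => v b.1 b.2 := by
    rw [hc, Matrix.vecMul_vecMul, Matrix.nonsing_inv_mul _ (isUnit_iff_ne_zero.2 hdet),
      Matrix.vecMul_one]
  have hv : v = ∑ a, c a • tupleField N (F a) z x := by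
    ext i k
    have := congrFun hcv (i, k)
    simp only [Matrix.vecMul, dotProduct, valueMatrix, Matrix.of_apply] at this
    simp [← this, tupleField]
  rw [hv]
  exact Submodule.sum_mem _ fun a _ =>
    Submodule.smul_mem _ _ (Submodule.subset_span (mem_range_self a))

lemma matchesWithReadout_of_eventually_reach
    {V : Fin d → EuclideanSpace ℝ (Fin m) × EuclideanSpace ℝ (Fin l) → EuclideanSpace ℝ (Fin m)}
    {z : EuclideanSpace ℝ (Fin l)} {x : Fin N → EuclideanSpace ℝ (Fin m)}
    (h : ∀ᶠ w in 𝓝 x, Reach (fun j => tupleField N (V j) z) x w)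
    (y : Fin N → EuclideanSpace ℝ (Fin m)) :
    MatchesWithReadout (fun j w => V j (w, z)) x y := by
  have hc : ContinuousAt (fun t : ℝ => x + t • y) 0 := by fun_prop
  rw [ContinuousAt, zero_smul, add_zero] at hc
  obtain ⟨t, ht, ht0⟩ := ((hc.eventually h).filter_mono nhdsWithin_le_nhds |>.and
    (self_mem_nhdsWithin (s := Ioi (0 : ℝ)))).exists
  obtain ⟨u, hu, -, X, hX0, hX1, hX⟩ := ht
  refine ⟨t⁻¹, inv_pos.2 ht0, u, hu, fun i => ⟨fun s => X s i, ?_, fun s _ => ?_, ?_⟩⟩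
  · exact congrFun (hX0 0 le_rfl) i
  · have := hasDerivAt_pi.1 (hX s) i
    simpa [tupleField] using this
  · simp [hX1 1 le_rfl, smul_smul, inv_mul_cancel₀ ht0.ne']

end Interpolation

/-- let `m ≥ 2`, `Ω ⊂ ℝ^m` bounded open connected, `d ≥ 5`, and let
`V_i(·,·) : ℝ^m × ℝ^l → ℝ^m` be real analytic on a neighborhood of `cl(Ω) × ℝ^l`, such
that for some `ẑ` the Lie algebra of the `V_i(·,ẑ)` contains all polynomial vector fields.
Then there is a Lebesgue nullset `ℳ ⊂ ℝ^l` such that for every `z ∉ ℳ` and every `N` there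
is a Lebesgue nullset `𝒩_N ⊂ Ω^N` such that every tuple in `Ω^N ∖ 𝒩_N` can be matched, via
a constant `λ > 0` and smooth controls, to any tuple of pairwise distinct targets in `Ω`
through the readout `y_i = λ(X^{x_i}_1 − x_i)`.  Consequently, if `Z` has a density on
`ℝ^l` and the inputs are drawn from a density on `(ℝ^m)^N`, the matching property holds
with probability one. -/
theorem generic_universal_interpolation
    (m : ℕ) (hm : 2 ≤ m)
    (Ω : Set (EuclideanSpace ℝ (Fin m)))
    (hΩbdd : Bornology.IsBounded Ω) (hΩopen : IsOpen Ω) (hΩconn : IsConnected Ω)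
    (d : ℕ) (hd : 5 ≤ d) (l : ℕ)
    (V : Fin d → (EuclideanSpace ℝ (Fin m) × EuclideanSpace ℝ (Fin l)) →
      EuclideanSpace ℝ (Fin m))
    (hVanalytic : ∃ U : Set (EuclideanSpace ℝ (Fin m) × EuclideanSpace ℝ (Fin l)),
      IsOpen U ∧ (closure Ω) ×ˢ (Set.univ : Set (EuclideanSpace ℝ (Fin l))) ⊆ U ∧
      ∀ i, AnalyticOnNhd ℝ (V i) U)
    (zhat : EuclideanSpace ℝ (Fin l))
    (hLie : ∀ P : EuclideanSpace ℝ (Fin m) → EuclideanSpace ℝ (Fin m), IsPolyVF P →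
      P ∈ lieGen (Set.range fun i => fun x => V i (x, zhat))) :
    ∃ ℳ : Set (EuclideanSpace ℝ (Fin l)), volume ℳ = 0 ∧
      (∀ z ∉ ℳ, ∀ N : ℕ,
        ∃ 𝒩 : Set (Fin N → EuclideanSpace ℝ (Fin m)), volume 𝒩 = 0 ∧
          𝒩 ⊆ {xbar | ∀ i, xbar i ∈ Ω} ∧
          ∀ xbar : Fin N → EuclideanSpace ℝ (Fin m), (∀ i, xbar i ∈ Ω) → xbar ∉ 𝒩 →
            ∀ y : Fin N → EuclideanSpace ℝ (Fin m), (∀ i, y i ∈ Ω) →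
              Function.Injective y →
              MatchesWithReadout (fun i x => V i (x, z)) xbar y) ∧
      -- Consequently: randomly drawn parameters and inputs match with probability one
      (∀ μ : Measure (EuclideanSpace ℝ (Fin l)), IsProbabilityMeasure μ → μ ≪ volume →
        ∀ᵐ z ∂μ, ∀ N : ℕ,
          ∀ ν : Measure (Fin N → EuclideanSpace ℝ (Fin m)),
            IsProbabilityMeasure ν → ν ≪ volume →
            ∀ᵐ xbar ∂ν, (∀ i, xbar i ∈ Ω) →
              ∀ y : Fin N → EuclideanSpace ℝ (Fin m), (∀ i, y i ∈ Ω) →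
                Function.Injective y →
                MatchesWithReadout (fun i x => V i (x, z)) xbar y) := by
  obtain ⟨U, hUo, hΩU, hV⟩ := hVanalytic
  have hmem : ∀ x ∈ Ω, ∀ z, (x, z) ∈ U := fun x hx z => hΩU ⟨subset_closure hx, trivial⟩
  have : Nontrivial (EuclideanSpace ℝ (Fin m)) := by
    have : Nontrivial (Fin m) := Fin.nontrivial_iff_two_le.2 hm
    infer_instance
  have hinf : Ω.Infinite := by
    obtain ⟨x, hx⟩ := hΩconn.nonempty
    exact infinite_of_mem_nhds x (hΩopen.mem_nhds hx)
  have hpts : ∀ N : ℕ, ∃ x : Fin N → EuclideanSpace ℝ (Fin m),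
      Function.Injective x ∧ ∀ i, x i ∈ Ω := fun N =>
    ⟨fun i => hinf.natEmbedding _ i, fun i j hij => Fin.ext <|
      (hinf.natEmbedding _).injective (Subtype.ext hij), fun i => (hinf.natEmbedding _ i).2⟩
  choose xs hxs hxsΩ using hpts
  have hF : ∀ (N : ℕ) (a : Fin N × Fin m), ∃ F, ParamLie V F ∧ ∀ b : Fin N × Fin m,
      F (xs N b.1, zhat) b.2 = (1 : Matrix (Fin N × Fin m) (Fin N × Fin m) ℝ) a b := by
    intro N a
    obtain ⟨P, hP, hPv⟩ := exists_isPolyVF_eq_single (hxs N) a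
    obtain ⟨F, hF, hFP⟩ := exists_paramLie_of_mem_lieGen (hLie P hP)
    exact ⟨F, hF, fun b => by rw [hFP, hPv]⟩
  choose F hF hFv using hF
  have hFa := fun N => analyticOnNhd_det_valueMatrix fun a => (hF N a).analyticOnNhd hUo hV
  set Mz : ℕ → Set (EuclideanSpace ℝ (Fin l)) :=
    fun N => {z | z ∈ univ ∧ (valueMatrix (F N) (xs N, z)).det = 0} with hMz
  have hM : volume (⋃ N, Mz N) = 0 := by
    refine measure_iUnion_null fun N => measure_zeros_eq_zero volume
      (f := fun z => (valueMatrix (F N) (xs N, z)).det) (b := zhat) (fun z _ => ?_)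
      isOpen_univ isPreconnected_univ trivial ?_
    · exact AnalyticAt.comp (g := fun u => (valueMatrix (F N) u).det)
        (hFa N (xs N, z) fun i => hmem _ (hxsΩ N i) z) (analyticAt_const.prod analyticAt_id)
    · have : valueMatrix (F N) (xs N, zhat) = 1 := by
        ext a b
        exact hFv N a b
      simp [this]
  have hmain : ∀ z ∉ ⋃ N, Mz N, ∀ N : ℕ,
      ∃ 𝒩 : Set (Fin N → EuclideanSpace ℝ (Fin m)), volume 𝒩 = 0 ∧
        𝒩 ⊆ {xbar | ∀ i, xbar i ∈ Ω} ∧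
        ∀ xbar : Fin N → EuclideanSpace ℝ (Fin m), (∀ i, xbar i ∈ Ω) → xbar ∉ 𝒩 →
          ∀ y : Fin N → EuclideanSpace ℝ (Fin m), (∀ i, y i ∈ Ω) →
            Function.Injective y →
            MatchesWithReadout (fun i x => V i (x, z)) xbar y := by
    intro z hz N
    set Ω' : Set (Fin N → EuclideanSpace ℝ (Fin m)) := univ.pi fun _ => Ω with hΩ'
    have hΩ'o : IsOpen Ω' := isOpen_set_pi finite_univ fun _ _ => hΩopen
    have hga : AnalyticOnNhd ℝ (fun x => (valueMatrix (F N) (x, z)).det) Ω' := fun x hx =>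
      AnalyticAt.comp (g := fun u => (valueMatrix (F N) u).det)
        (hFa N (x, z) fun i => hmem _ (hx i trivial) z) (analyticAt_id.prod analyticAt_const)
    refine ⟨{x | x ∈ Ω' ∧ (valueMatrix (F N) (x, z)).det = 0},
      measure_zeros_eq_zero volume hga hΩ'o
        (isPreconnected_univ_pi fun _ => hΩconn.isPreconnected) (b := xs N)
        (fun i _ => hxsΩ N i) fun h0 => hz (mem_iUnion.2 ⟨N, trivial, h0⟩),
      fun x hx i => hx.1 i trivial, fun x hx hxN y _ _ => ?_⟩
    refine matchesWithReadout_of_eventually_reach (eventually_reach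
      (D := Ω' ∩ (fun x => (valueMatrix (F N) (x, z)).det) ⁻¹' {0}ᶜ)
      (hga.continuousOn.isOpen_inter_preimage hΩ'o isOpen_compl_singleton)
      ⟨fun i _ => hx i, fun h0 => hxN ⟨fun i _ => hx i, h0⟩⟩ (fun j => ?_) fun q hq => ?_) y
    · exact (analyticOnNhd_tupleField (hV j) z).mono fun q hq i => hmem _ (hq.1 i trivial) z
    · rw [eq_top_iff, ← span_tupleField_eq_top hq.2]
      refine Submodule.span_mono ?_
      rintro _ ⟨a, rfl⟩
      exact ⟨_, (hF N a).lieOn_tupleField hUo hV fun q hq i => hmem _ (hq.1 i trivial) z, rfl⟩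
  refine ⟨⋃ N, Mz N, hM, hmain, fun μ _ hμ => ?_⟩
  filter_upwards [hμ.ae_le (compl_mem_ae_iff.2 hM)] with z hz N ν _ hν
  obtain ⟨𝒩, h𝒩, -, hmatch⟩ := hmain z hz N
  filter_upwards [hν.ae_le (compl_mem_ae_iff.2 h𝒩)] with x hx hxΩ using hmatch x hxΩ hx
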